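/- Let M ∈ ℝ^{2n×2n} be symmetric positive-definite with symplectic eigenvalues d₁ ≤ ... ≤ dₙ. A matrix X* ∈ Sp(2k,2n) is a global minimizer of f(X) = tr(XᵀMX) over Sp(2k,2n) if and only if there exists an orthosymplectic K ∈ OrSp(2k) such that M(X*K) = J_{2n}(X*K)·[[0, −D_{1:k}], [D_{1:k}, 0]] with D_{1:k} = diag(d₁, ..., d_k), i.e., the columns of X*K form a normalized symplectic eigenvector set of M associated with the k smallest symplectic eigenvalues d₁, ..., d_k. -/

import Mathlib

open Matrix

noncomputable section

/-- Index type for `2n`-dimensional objects: first copy for indices `1..n`,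
second copy for indices `n+1..2n`. -/
abbrev Idx (n : ℕ) := Fin n ⊕ Fin n

/-- The Poisson matrix `J_{2n} = [[0, I], [-I, 0]]`. -/
def Jmat (n : ℕ) : Matrix (Idx n) (Idx n) ℝ := fromBlocks 0 1 (-1) 0

/-- `X ∈ Sp(2k, 2n)`, i.e. `Xᵀ J_{2n} X = J_{2k}`. -/
def Symplectic {n k : ℕ} (X : Matrix (Idx n) (Idx k) ℝ) : Prop :=
  Xᵀ * Jmat n * X = Jmat k

/-- `K ∈ OrSp(2n)`, i.e. `KᵀK = I` and `Kᵀ J K = J`. -/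
def OrthoSymplectic {n : ℕ} (K : Matrix (Idx n) (Idx n) ℝ) : Prop :=
  Kᵀ * K = 1 ∧ Symplectic K

/-- The block-diagonal matrix `diag(D, D)` with `D = diagonal d`. -/
def diagPair {n : ℕ} (d : Fin n → ℝ) : Matrix (Idx n) (Idx n) ℝ :=
  fromBlocks (diagonal d) 0 0 (diagonal d)

/-- The matrix `[[0, -Λ], [Λ, 0]]` with `Λ = diagonal lam`. -/
def offPair {k : ℕ} (lam : Fin k → ℝ) : Matrix (Idx k) (Idx k) ℝ :=
  fromBlocks 0 (-(diagonal lam)) (diagonal lam) 0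

theorem Jmat_mul_Jmat (n : ℕ) : Jmat n * Jmat n = -1 := by
  simp [Jmat, fromBlocks_multiply, ← fromBlocks_one, fromBlocks_neg]

theorem Jmat_transpose (n : ℕ) : (Jmat n)ᵀ = -Jmat n := by
  simp [Jmat, fromBlocks_transpose, fromBlocks_neg]

theorem Jmat_mul_Jmat_mul {n : ℕ} {m : Type*} (A : Matrix (Idx n) m ℝ) :
    Jmat n * (Jmat n * A) = -A := by
  rw [← Matrix.mul_assoc, Jmat_mul_Jmat]; simp

theorem mul_Jmat_mul_Jmat {n : ℕ} {m : Type*} (A : Matrix m (Idx n) ℝ) :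
    A * Jmat n * Jmat n = -A := by
  rw [Matrix.mul_assoc, Jmat_mul_Jmat]; simp

theorem Symplectic.mul {n k l : ℕ} {S : Matrix (Idx n) (Idx k) ℝ} {X : Matrix (Idx k) (Idx l) ℝ}
    (hS : Symplectic S) (hX : Symplectic X) : Symplectic (S * X) := by
  unfold Symplectic at *
  rw [← hX, ← hS]
  simp only [transpose_mul, Matrix.mul_assoc]

/-- Symplectic transvections are symplectic. -/
theorem symplectic_transvection {n : ℕ} (h : Idx n → ℝ) (t : ℝ) :
    Symplectic (1 + t • (Jmat n * vecMulVec h h)) := by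
  have h0 : vecMulVec h h * Jmat n * vecMulVec h h = 0 := by
    have : h ᵥ* Jmat n ⬝ᵥ h = 0 := by
      have h1 : h ᵥ* Jmat n ⬝ᵥ h = -(h ᵥ* Jmat n ⬝ᵥ h) := by
        nth_rewrite 1 [dotProduct_comm, ← mulVec_transpose, Jmat_transpose]
        rw [neg_mulVec, dotProduct_neg, dotProduct_mulVec]
      linarith
    rw [vecMulVec_mul, vecMulVec_mul_vecMulVec, this, zero_smul, vecMulVec_zero]
  unfold Symplectic
  simp only [transpose_add, transpose_one, transpose_smul, transpose_mul, transpose_vecMulVec,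
    Jmat_transpose, Matrix.add_mul, Matrix.mul_add, Matrix.mul_one, Matrix.one_mul, Matrix.mul_neg,
    Matrix.neg_mul, Matrix.smul_mul, Matrix.mul_smul, Jmat_mul_Jmat_mul, mul_Jmat_mul_Jmat,
    smul_neg, neg_neg]
  rw [← Matrix.mul_assoc, h0]
  simp

theorem transpose_eq_neg_of_dotProduct_mulVec {ι : Type*} [Fintype ι] [DecidableEq ι]
    (G : Matrix ι ι ℝ)
    (hG : ∀ h : ι → ℝ, h ⬝ᵥ G *ᵥ h = 0) : Gᵀ = -G := by
  ext i j
  have h1 := hG (Pi.single i 1 + Pi.single j 1)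
  have h2 := hG (Pi.single i 1)
  have h3 := hG (Pi.single j 1)
  simp [mulVec_add] at h1 h2 h3
  simp
  linarith

theorem eq_zero_of_forall_quadratic_nonneg {b c : ℝ} (h : ∀ t : ℝ, 0 ≤ t * b + t ^ 2 * c) :
    b = 0 := by
  by_contra hb
  have hc : 0 < |c| + 1 := by positivity
  have h1 := h (-b / (|c| + 1))
  have h2 : -b / (|c| + 1) * b + (-b / (|c| + 1)) ^ 2 * c
      = b ^ 2 * (c - |c| - 1) / (|c| + 1) ^ 2 := by
    field_simp
    ring
  rw [h2] at h1
  have h3 : b ^ 2 * (c - |c| - 1) < 0 :=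
    mul_neg_of_pos_of_neg (by positivity) (by linarith [le_abs_self c])
  have := div_neg_of_neg_of_pos h3 (by positivity : 0 < (|c| + 1) ^ 2)
  linarith

/-- First-order optimality condition for `tr(XᵀMX)` over the symplectic matrices. -/
theorem optimality_condition {n k : ℕ} {M : Matrix (Idx n) (Idx n) ℝ} (hM : Mᵀ = M)
    {X : Matrix (Idx n) (Idx k) ℝ} (hX : Symplectic X)
    (hmin : ∀ Y : Matrix (Idx n) (Idx k) ℝ, Symplectic Y →
        (Xᵀ * M * X).trace ≤ (Yᵀ * M * Y).trace) :
    M * X = -(Jmat n * X * (Xᵀ * M * X) * Jmat k) := by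
  have key : ∀ h : Idx n → ℝ, h ⬝ᵥ (X * Xᵀ * M * Jmat n) *ᵥ h = 0 := by
    intro h
    set P := vecMulVec h h with hP
    set B := Jmat n * P * X with hB
    have hb : (Xᵀ * M * B).trace = h ⬝ᵥ (X * Xᵀ * M * Jmat n) *ᵥ h := by
      rw [hB, trace_mul_comm, hP]
      rw [trace_mul_comm, dotProduct_comm, ← trace_vecMulVec, ← mul_vecMulVec]
      rw [← Matrix.mul_assoc, trace_mul_comm]
      simp only [Matrix.mul_assoc]
    have hbt : (Bᵀ * M * X).trace = (Xᵀ * M * B).trace := by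
      rw [← trace_transpose]
      simp only [transpose_mul, transpose_transpose, hM, Matrix.mul_assoc]
    have : 2 * (Xᵀ * M * B).trace = 0 := by
      refine eq_zero_of_forall_quadratic_nonneg (c := (Bᵀ * M * B).trace) fun t => ?_
      have h1 := hmin _ ((symplectic_transvection h t).mul hX)
      have h2 : (1 + t • (Jmat n * vecMulVec h h)) * X = X + t • B := by
        rw [Matrix.add_mul, Matrix.one_mul, Matrix.smul_mul]
      rw [h2] at h1
      simp only [transpose_add, transpose_smul, Matrix.add_mul, Matrix.mul_add, Matrix.smul_mul,
        Matrix.mul_smul, trace_add, trace_smul, smul_eq_mul, hbt] at h1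
      linarith
    linarith
  have hG := transpose_eq_neg_of_dotProduct_mulVec _ key
  simp only [transpose_mul, transpose_transpose, hM, Jmat_transpose] at hG
  have h1 : Jmat n * M * X * Jmat k = -(X * (Xᵀ * M * X)) := by
    have h2 := congrArg (· * (Jmat n * X)) hG
    have h3 : Xᵀ * (Jmat n * X) = Jmat k := by rw [← Matrix.mul_assoc]; exact hX
    simp only [Matrix.neg_mul, neg_inj, Matrix.mul_assoc, h3, Jmat_mul_Jmat_mul,
      Matrix.mul_neg] at h2
    simpa only [Matrix.mul_assoc] using h2
  have h4 := congrArg (fun Z => Jmat n * Z * Jmat k) h1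
  simp only [Matrix.mul_assoc, Jmat_mul_Jmat, Jmat_mul_Jmat_mul, Matrix.mul_neg,
    Matrix.neg_mul, Matrix.mul_one, neg_neg] at h4
  simpa only [Matrix.mul_assoc] using h4

/-- Real `2k × 2k` matrix of a complex `k × k` matrix. -/
def realify {k : ℕ} (H : Matrix (Fin k) (Fin k) ℂ) : Matrix (Idx k) (Idx k) ℝ :=
  fromBlocks (H.map Complex.re) (-(H.map Complex.im)) (H.map Complex.im) (H.map Complex.re)

theorem realify_mul {k : ℕ} (G H : Matrix (Fin k) (Fin k) ℂ) :
    realify (G * H) = realify G * realify H := by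
  rw [realify, realify, realify, fromBlocks_multiply]
  congr 1 <;> ext i j <;>
    simp [Matrix.mul_apply, Complex.mul_re, Complex.mul_im, Finset.sum_add_distrib,
      sub_eq_add_neg, add_comm]

theorem realify_one {k : ℕ} : realify (1 : Matrix (Fin k) (Fin k) ℂ) = 1 := by
  rw [realify, ← fromBlocks_one]
  congr 1 <;> ext i j <;> by_cases h : i = j <;> simp [h, Matrix.one_apply]

theorem realify_conjTranspose {k : ℕ} (H : Matrix (Fin k) (Fin k) ℂ) :
    realify Hᴴ = (realify H)ᵀ := by
  rw [realify, realify, fromBlocks_transpose]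
  congr 1
  ext i j
  simp

theorem realify_diagonal {k : ℕ} (l : Fin k → ℝ) :
    realify (diagonal fun i => (l i : ℂ)) = diagPair l := by
  rw [realify, diagPair]
  congr 1 <;> (ext i j; by_cases h : i = j <;> simp [h])

theorem Jmat_mul_realify {k : ℕ} (H : Matrix (Fin k) (Fin k) ℂ) :
    Jmat k * realify H = realify H * Jmat k := by
  simp [realify, Jmat, fromBlocks_multiply]

theorem exists_realify_eq {k : ℕ} {A : Matrix (Idx k) (Idx k) ℝ}
    (hA : Jmat k * A = A * Jmat k) : ∃ H, realify H = A := by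
  rw [← fromBlocks_toBlocks A, Jmat, fromBlocks_multiply, fromBlocks_multiply, fromBlocks_inj] at hA
  simp only [Matrix.zero_mul, Matrix.one_mul, Matrix.neg_mul, Matrix.mul_zero, Matrix.mul_neg,
    Matrix.mul_one, zero_add, add_zero] at hA
  obtain ⟨h1, h2, -, -⟩ := hA
  refine ⟨Matrix.of fun i j => ⟨A.toBlocks₁₁ i j, A.toBlocks₂₁ i j⟩, ?_⟩
  conv_rhs => rw [← fromBlocks_toBlocks A, h2]
  rw [realify]
  have h3 : A.toBlocks₁₂ = - A.toBlocks₂₁ := by rw [h1, neg_neg]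
  rw [h3]
  rfl

theorem realify_injective {k : ℕ} :
    Function.Injective (realify : Matrix (Fin k) (Fin k) ℂ → _) := by
  intro G H h
  rw [realify, realify, fromBlocks_inj] at h
  ext i j
  exact Complex.ext (congrFun (congrFun h.1 i) j) (congrFun (congrFun h.2.2.1 i) j)

/-- A symmetric matrix commuting with `J` is diagonalized by an orthosymplectic matrix. -/
theorem exists_orthoSymplectic_diag {k : ℕ} {A : Matrix (Idx k) (Idx k) ℝ} (hA : Aᵀ = A)
    (hJ : Jmat k * A = A * Jmat k) :
    ∃ (K : Matrix (Idx k) (Idx k) ℝ) (l : Fin k → ℝ), OrthoSymplectic K ∧ Monotone l ∧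
      A * K = K * diagPair l := by
  obtain ⟨H, rfl⟩ := exists_realify_eq hJ
  have hH : H.IsHermitian := realify_injective (by rw [realify_conjTranspose, hA])
  set s := Tuple.sort hH.eigenvalues
  set V : Matrix (Fin k) (Fin k) ℂ :=
    (hH.eigenvectorUnitary : Matrix (Fin k) (Fin k) ℂ).submatrix id s with hV
  have hVV : Vᴴ * V = 1 := by
    rw [hV, conjTranspose_submatrix, ← submatrix_mul _ _ _ _ _ Function.bijective_id]
    rw [← star_eq_conjTranspose, Unitary.coe_star_mul_self, submatrix_one_equiv]
  have hHV : H * V = V * diagonal fun i => ((hH.eigenvalues (s i) : ℝ) : ℂ) := by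
    ext i j
    rw [mul_diagonal, hV, submatrix_apply, hH.eigenvectorUnitary_apply, id, mul_comm]
    have := congrFun (hH.mulVec_eigenvectorBasis (s j)) i
    simpa [Matrix.mul_apply, mulVec, dotProduct, hH.eigenvectorUnitary_apply] using this
  have hK : (realify V)ᵀ * realify V = 1 := by
    rw [← realify_conjTranspose, ← realify_mul, hVV, realify_one]
  refine ⟨realify V, hH.eigenvalues ∘ s, ⟨hK, ?_⟩, Tuple.monotone_sort _, ?_⟩
  · rw [Symplectic, Matrix.mul_assoc, Jmat_mul_realify, ← Matrix.mul_assoc, hK, Matrix.one_mul]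
  · rw [← realify_mul, hHV, realify_mul, realify_diagonal]
    rfl

theorem diagPair_eq_diagonal {n : ℕ} (d : Fin n → ℝ) : diagPair d = diagonal (Sum.elim d d) :=
  fromBlocks_diagonal d d

theorem Jmat_mul_offPair {k : ℕ} (l : Fin k → ℝ) : Jmat k * offPair l = diagPair l := by
  simp [Jmat, offPair, diagPair, fromBlocks_multiply]

theorem diagPair_mul_Jmat {k : ℕ} (l : Fin k → ℝ) : diagPair l * Jmat k = -offPair l := by
  rw [Jmat, offPair, diagPair, fromBlocks_multiply, fromBlocks_neg]
  simp

theorem Jmat_mul_diagPair {k : ℕ} (l : Fin k → ℝ) :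
    Jmat k * diagPair l = diagPair l * Jmat k := by
  rw [Jmat, diagPair, fromBlocks_multiply, fromBlocks_multiply]
  simp

theorem offPair_mul_offPair {k : ℕ} (l : Fin k → ℝ) :
    offPair l * offPair l = -diagPair fun i => l i ^ 2 := by
  simp [offPair, diagPair, fromBlocks_multiply, sq]

theorem trace_diagPair {k : ℕ} (l : Fin k → ℝ) : (diagPair l).trace = 2 * ∑ i, l i := by
  simp [diagPair_eq_diagonal, trace_diagonal, two_mul]

theorem Symplectic.mulVec_injective {n k : ℕ} {X : Matrix (Idx n) (Idx k) ℝ}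
    (hX : Symplectic X) : Function.Injective X.mulVec := by
  have h : -(Jmat k * Xᵀ * Jmat n) * X = 1 := by
    rw [Matrix.neg_mul, Matrix.mul_assoc, Matrix.mul_assoc, ← Matrix.mul_assoc Xᵀ, hX,
      Jmat_mul_Jmat, neg_neg]
  intro v w hvw
  have := congrArg (fun u => (-(Jmat k * Xᵀ * Jmat n)) *ᵥ u) hvw
  simpa only [mulVec_mulVec, h, one_mulVec] using this

theorem Symplectic.submatrix_castLE {n k m : ℕ} {X : Matrix (Idx n) (Idx k) ℝ}
    (hX : Symplectic X) (h : m ≤ k) :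
    Symplectic (X.submatrix id (Sum.map (Fin.castLE h) (Fin.castLE h))) := by
  have h1 := congrArg
    (fun Z => Z.submatrix (Sum.map (Fin.castLE h) (Fin.castLE h))
      (Sum.map (Fin.castLE h) (Fin.castLE h))) hX
  have h2 : (Jmat k).submatrix (Sum.map (Fin.castLE h) (Fin.castLE h))
      (Sum.map (Fin.castLE h) (Fin.castLE h)) = Jmat m := by
    ext (i | i) (j | j) <;> simp [Jmat, Matrix.one_apply]
  rw [Symplectic, ← h2, ← h1]
  rfl

theorem OrthoSymplectic.Jmat_mul {k : ℕ} {K : Matrix (Idx k) (Idx k) ℝ}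
    (hK : OrthoSymplectic K) : Jmat k * K = K * Jmat k := by
  conv_rhs => rw [← hK.2]
  rw [Matrix.mul_assoc Kᵀ, ← Matrix.mul_assoc K, mul_eq_one_comm.mp hK.1, Matrix.one_mul]

theorem OrthoSymplectic.trace_conj {n k : ℕ} {K : Matrix (Idx k) (Idx k) ℝ}
    (hK : OrthoSymplectic K) (M : Matrix (Idx n) (Idx n) ℝ) (X : Matrix (Idx n) (Idx k) ℝ) :
    ((X * K)ᵀ * M * (X * K)).trace = (Xᵀ * M * X).trace := by
  rw [transpose_mul, ← Matrix.mul_assoc, trace_mul_comm]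
  simp only [← Matrix.mul_assoc]
  rw [mul_eq_one_comm.mp hK.1, Matrix.one_mul]

/-- The columns of a minimizer of `tr(XᵀMX)` are, up to an orthosymplectic factor, a normalized
symplectic eigenvector set. -/
theorem exists_orthoSymplectic_eigenvectors {n k : ℕ} {M : Matrix (Idx n) (Idx n) ℝ} (hM : Mᵀ = M)
    {X : Matrix (Idx n) (Idx k) ℝ} (hX : Symplectic X)
    (hmin : ∀ Y : Matrix (Idx n) (Idx k) ℝ, Symplectic Y →
        (Xᵀ * M * X).trace ≤ (Yᵀ * M * Y).trace) :
    ∃ (K : Matrix (Idx k) (Idx k) ℝ) (l : Fin k → ℝ), OrthoSymplectic K ∧ Monotone l ∧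
      M * (X * K) = Jmat n * (X * K) * offPair l := by
  have hopt := optimality_condition hM hX hmin
  have hA : (Xᵀ * M * X)ᵀ = Xᵀ * M * X := by
    simp only [transpose_mul, transpose_transpose, hM, Matrix.mul_assoc]
  have hJ : Jmat k * (Xᵀ * M * X) = Xᵀ * M * X * Jmat k := by
    conv_lhs => rw [Matrix.mul_assoc Xᵀ, hopt, Matrix.mul_neg]
    have h : Xᵀ * (Jmat n * X * (Xᵀ * M * X) * Jmat k)
        = Xᵀ * Jmat n * X * (Xᵀ * M * X * Jmat k) := by simp only [Matrix.mul_assoc]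
    rw [h, hX, Matrix.mul_neg, Jmat_mul_Jmat_mul, neg_neg]
  obtain ⟨K, l, hK, hl, hKl⟩ := exists_orthoSymplectic_diag hA hJ
  refine ⟨K, l, hK, hl, ?_⟩
  rw [← Matrix.mul_assoc, hopt, Matrix.neg_mul, Matrix.mul_assoc, hK.Jmat_mul,
    Matrix.mul_assoc (Jmat n * X), ← Matrix.mul_assoc _ K, hKl, Matrix.mul_assoc K,
    diagPair_mul_Jmat]
  simp only [Matrix.mul_neg, neg_neg, Matrix.mul_assoc]

theorem Symplectic.transpose_mul_mul_eq_diagPair {n k : ℕ} {M : Matrix (Idx n) (Idx n) ℝ}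
    {W : Matrix (Idx n) (Idx k) ℝ} (hW : Symplectic W) {l : Fin k → ℝ}
    (h : M * W = Jmat n * W * offPair l) : Wᵀ * M * W = diagPair l := by
  rw [Matrix.mul_assoc, h, ← Matrix.mul_assoc, ← Matrix.mul_assoc, hW, Jmat_mul_offPair]

/-- The `i`-th smallest symplectic eigenvalue carried by a symplectic frame is at least the `i`-th
smallest one of the whole matrix. -/
theorem le_of_symplectic_eigenvectors {n k : ℕ} (hk : k ≤ n) {d : Fin n → ℝ} (hd : ∀ j, 0 < d j)
    (hmono : Monotone d) {W : Matrix (Idx n) (Idx k) ℝ} (hW : Symplectic W) {l : Fin k → ℝ}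
    (hl : Monotone l) (h : diagPair d * W = Jmat n * W * offPair l) (i : Fin k) :
    d (Fin.castLE hk i) ≤ l i := by
  by_contra! hlt
  have hpos : ∀ a, 0 < l a := by
    intro a
    have hD : (diagPair d).PosDef := by
      rw [diagPair_eq_diagonal]
      exact PosDef.diagonal (by rintro (j | j) <;> exact hd j)
    have h1 := (hD.conjTranspose_mul_mul_same hW.mulVec_injective).diag_pos (i := Sum.inl a)
    rw [conjTranspose_eq_transpose_of_trivial, hW.transpose_mul_mul_eq_diagPair h] at h1
    simpa [diagPair] using h1
  have hsq : diagPair d * (diagPair d * W) = W * diagPair fun a => l a ^ 2 := by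
    rw [h, ← Matrix.mul_assoc, ← Matrix.mul_assoc, ← Jmat_mul_diagPair, Matrix.mul_assoc (Jmat n),
      h, ← Matrix.mul_assoc, Jmat_mul_Jmat_mul, Matrix.mul_assoc, offPair_mul_offPair]
    simp only [Matrix.mul_neg, Matrix.neg_mul, neg_neg]
  have hentry : ∀ r c, Sum.elim d d r ≠ Sum.elim l l c → W r c = 0 := by
    intro r c hrc
    have h1 := congrFun (congrFun hsq r) c
    simp only [diagPair_eq_diagonal, diagonal_mul, mul_diagonal] at h1
    by_contra h2
    apply hrc
    have h3 : Sum.elim d d r ^ 2 = Sum.elim l l c ^ 2 := by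
      have h4 : (Sum.elim (fun a => l a ^ 2) (fun a => l a ^ 2) c : ℝ) = Sum.elim l l c ^ 2 := by
        rcases c with c | c <;> rfl
      rw [h4] at h1
      exact mul_right_cancel₀ h2 (by linarith)
    refine (pow_left_inj₀ ?_ ?_ two_ne_zero).mp h3
    · rcases r with r | r <;> exact (hd r).le
    · rcases c with c | c <;> exact (hpos c).le
  have hi : i.1 + 1 ≤ k := i.2
  set C := W.submatrix id (Sum.map (Fin.castLE hi) (Fin.castLE hi)) with hC
  have hCinj : Function.Injective C.mulVec := (hW.submatrix_castLE hi).mulVec_injective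
  have hin : i.1 ≤ n := by omega
  set B := C.submatrix (Sum.map (Fin.castLE hin) (Fin.castLE hin)) id with hB
  have hBinj : Function.Injective B.mulVecLin := by
    intro v w hvw
    apply hCinj
    have hz : ∀ r c, i.1 ≤ Sum.elim Fin.val Fin.val r → C r c = 0 := by
      intro r c hr
      apply hentry
      have h1 : d (Fin.castLE hk i) ≤ Sum.elim d d r := by
        rcases r with r | r <;> exact hmono hr
      have h2 : Sum.elim l l (Sum.map (Fin.castLE hi) (Fin.castLE hi) c) ≤ l i := by
        rcases c with c | c <;> exact hl (Nat.lt_succ_iff.mp c.2)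
      exact (h2.trans_lt (hlt.trans_le h1)).ne'
    ext r
    by_cases hr : i.1 ≤ Sum.elim Fin.val Fin.val r
    · simp [mulVec, dotProduct, hz r _ hr]
    · rw [not_le] at hr
      rcases r with r | r
      · exact congrFun hvw (Sum.inl ⟨r, hr⟩)
      · exact congrFun hvw (Sum.inr ⟨r, hr⟩)
  have := LinearMap.finrank_le_finrank_of_injective hBinj
  simp at this
  omega

theorem exists_minimizer {n k : ℕ} (hk : k ≤ n) {d : Fin n → ℝ} (hd : ∀ j, 0 < d j) :
    ∃ X : Matrix (Idx n) (Idx k) ℝ, Symplectic X ∧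
      ∀ Y : Matrix (Idx n) (Idx k) ℝ, Symplectic Y →
        (Xᵀ * diagPair d * X).trace ≤ (Yᵀ * diagPair d * Y).trace := by
  set f : Matrix (Idx n) (Idx k) ℝ → ℝ := fun X => (Xᵀ * diagPair d * X).trace with hf
  have hfc : Continuous f := by fun_prop
  have hfe : ∀ X, f X = ∑ c, ∑ r, Sum.elim d d r * X r c ^ 2 := by
    intro X
    simp only [hf, trace, diag_apply, diagPair_eq_diagonal, Matrix.mul_apply (N := X), mul_diagonal,
      transpose_apply]
    exact Finset.sum_congr rfl fun c _ => Finset.sum_congr rfl fun r _ => by ring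
  have hpos : ∀ r, 0 < Sum.elim d d r := by rintro (j | j) <;> exact hd j
  set E : Matrix (Idx n) (Idx k) ℝ :=
    (1 : Matrix (Idx n) (Idx n) ℝ).submatrix id (Sum.map (Fin.castLE hk) (Fin.castLE hk))
  have hE : Symplectic E :=
    Symplectic.submatrix_castLE (by simp [Symplectic]) hk
  have hbox : IsCompact {X : Matrix (Idx n) (Idx k) ℝ |
      ∀ r, ∀ c, X r c ∈ Set.Icc (-√(f E / Sum.elim d d r)) (√(f E / Sum.elim d d r))} := by
    have := isCompact_pi_infinite (ι := Idx n) (X := fun _ => Idx k → ℝ)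
      fun r => isCompact_pi_infinite fun _ : Idx k =>
        isCompact_Icc (a := -√(f E / Sum.elim d d r)) (b := √(f E / Sum.elim d d r))
    exact this
  have hcomp : IsCompact {X : Matrix (Idx n) (Idx k) ℝ | Symplectic X ∧ f X ≤ f E} := by
    refine hbox.of_isClosed_subset (.inter (isClosed_eq (by fun_prop) (by fun_prop))
      (isClosed_le hfc continuous_const)) ?_
    rintro X ⟨-, hX⟩ r c
    have h1 : Sum.elim d d r * X r c ^ 2 ≤ f E := by
      refine le_trans ?_ hX
      rw [hfe]
      have hnn : ∀ c r, 0 ≤ Sum.elim d d r * X r c ^ 2 := fun c r =>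
        mul_nonneg (hpos r).le (sq_nonneg _)
      exact (Finset.single_le_sum (f := fun r => Sum.elim d d r * X r c ^ 2)
        (fun r _ => hnn c r) (Finset.mem_univ r)).trans
        (Finset.single_le_sum (f := fun c => ∑ r, Sum.elim d d r * X r c ^ 2)
          (fun c _ => Finset.sum_nonneg fun r _ => hnn c r) (Finset.mem_univ c))
    rw [Set.mem_Icc, ← abs_le]
    apply Real.abs_le_sqrt
    rwa [le_div_iff₀ (hpos r), mul_comm]
  obtain ⟨X, ⟨hX, -⟩, hmin⟩ := hcomp.exists_isMinOn ⟨E, hE, le_rfl⟩ hfc.continuousOn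
  refine ⟨X, hX, fun Y hY => ?_⟩
  by_cases hYE : f Y ≤ f E
  · exact hmin ⟨hY, hYE⟩
  · exact (hmin ⟨hE, le_rfl⟩).trans (not_le.mp hYE).le

theorem two_mul_sum_le_trace {n k : ℕ} (hk : k ≤ n) {d : Fin n → ℝ} (hd : ∀ j, 0 < d j)
    (hmono : Monotone d)
    {Y : Matrix (Idx n) (Idx k) ℝ} (hY : Symplectic Y) :
    2 * ∑ j : Fin k, d (Fin.castLE hk j) ≤ (Yᵀ * diagPair d * Y).trace := by
  obtain ⟨X, hX, hmin⟩ := exists_minimizer hk hd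
  have hD : (diagPair d)ᵀ = diagPair d := by rw [diagPair_eq_diagonal, diagonal_transpose]
  obtain ⟨K, l, hK, hl, h⟩ := exists_orthoSymplectic_eigenvectors hD hX hmin
  have hW := hX.mul hK.2
  refine le_trans ?_ (hmin Y hY)
  rw [← hK.trace_conj, hW.transpose_mul_mul_eq_diagPair h, trace_diagPair]
  gcongr with i
  exact le_of_symplectic_eigenvectors hk hd hmono hW hl h i

theorem exists_trace_eq {n k : ℕ} (hk : k ≤ n) (d : Fin n → ℝ) :
    ∃ E : Matrix (Idx n) (Idx k) ℝ, Symplectic E ∧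
      (Eᵀ * diagPair d * E).trace = 2 * ∑ j : Fin k, d (Fin.castLE hk j) := by
  set φ : Idx k → Idx n := Sum.map (Fin.castLE hk) (Fin.castLE hk)
  refine ⟨(1 : Matrix (Idx n) (Idx n) ℝ).submatrix id φ,
    Symplectic.submatrix_castLE (by simp [Symplectic]) hk, ?_⟩
  have h : ((1 : Matrix (Idx n) (Idx n) ℝ).submatrix id φ)ᵀ * diagPair d
      * (1 : Matrix (Idx n) (Idx n) ℝ).submatrix id φ
      = (1ᵀ * diagPair d * 1 : Matrix (Idx n) (Idx n) ℝ).submatrix φ φ := rfl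
  rw [h]
  simp [diagPair_eq_diagonal, trace, φ, two_mul]

/-- The characterization of minimizers for `M = diag(D, D)`. -/
theorem diagPair_minimizer_iff {n k : ℕ} (hk : k ≤ n) {d : Fin n → ℝ} (hd : ∀ j, 0 < d j)
    (hmono : Monotone d) {X : Matrix (Idx n) (Idx k) ℝ} (hX : Symplectic X) :
    (∀ Y : Matrix (Idx n) (Idx k) ℝ, Symplectic Y →
        (Xᵀ * diagPair d * X).trace ≤ (Yᵀ * diagPair d * Y).trace) ↔
      ∃ K : Matrix (Idx k) (Idx k) ℝ, OrthoSymplectic K ∧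
        diagPair d * (X * K) =
          Jmat n * (X * K) * offPair (fun j : Fin k => d (Fin.castLE hk j)) := by
  constructor
  · intro hmin
    have hD : (diagPair d)ᵀ = diagPair d := by rw [diagPair_eq_diagonal, diagonal_transpose]
    obtain ⟨K, l, hK, hl, h⟩ := exists_orthoSymplectic_eigenvectors hD hX hmin
    have hW := hX.mul hK.2
    have hle := le_of_symplectic_eigenvectors hk hd hmono hW hl h
    obtain ⟨E, hE, hEt⟩ := exists_trace_eq hk d
    have h1 := hmin E hE
    rw [hEt, ← hK.trace_conj, hW.transpose_mul_mul_eq_diagPair h, trace_diagPair] at h1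
    have h2 : ∑ i, d (Fin.castLE hk i) = ∑ i, l i :=
      le_antisymm (Finset.sum_le_sum fun i _ => hle i) (by linarith)
    have h3 : (fun j : Fin k => d (Fin.castLE hk j)) = l := funext fun i =>
      (Finset.sum_eq_sum_iff_of_le fun i _ => hle i).mp h2 i (Finset.mem_univ i)
    exact ⟨K, hK, h3 ▸ h⟩
  · rintro ⟨K, hK, h⟩ Y hY
    rw [← hK.trace_conj, (hX.mul hK.2).transpose_mul_mul_eq_diagPair h, trace_diagPair]
    exact two_mul_sum_le_trace hk hd hmono hY

/-- `X*` is a global minimizer of `tr(XᵀMX)` over `Sp(2k,2n)` iff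
there is an orthosymplectic `K` such that the columns of `X*K` form a normalized
symplectic eigenvector set of `M` associated with the `k` smallest symplectic
eigenvalues `d₁, …, d_k`. -/
theorem global_minimizer_characterization {n k : ℕ} (hk : k ≤ n)
    (M : Matrix (Idx n) (Idx n) ℝ) (hM : M.PosDef)
    (d : Fin n → ℝ) (hd : ∀ j, 0 < d j) (hmono : Monotone d)
    (hW : ∃ S : Matrix (Idx n) (Idx n) ℝ, Symplectic S ∧ Sᵀ * M * S = diagPair d)
    (X : Matrix (Idx n) (Idx k) ℝ) (hX : Symplectic X) :
    (∀ Y : Matrix (Idx n) (Idx k) ℝ, Symplectic Y →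
        (Xᵀ * M * X).trace ≤ (Yᵀ * M * Y).trace) ↔
      ∃ K : Matrix (Idx k) (Idx k) ℝ, OrthoSymplectic K ∧
        M * (X * K) = Jmat n * (X * K) * offPair (fun j : Fin k => d (Fin.castLE hk j)) := by
  obtain ⟨S, hS, hSM⟩ := hW
  have hTS : -(Jmat n * Sᵀ * Jmat n) * S = 1 := by
    rw [Matrix.neg_mul, Matrix.mul_assoc, Matrix.mul_assoc, ← Matrix.mul_assoc Sᵀ, hS,
      Jmat_mul_Jmat, neg_neg]
  set T := -(Jmat n * Sᵀ * Jmat n)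
  have hST : S * T = 1 := mul_eq_one_comm.mp hTS
  have hTt : Tᵀ * Sᵀ = 1 := by rw [← transpose_mul, hST, transpose_one]
  have hT : Symplectic T := by
    have h1 := congrArg (fun Z => Tᵀ * Z * T) hS
    have h2 : Tᵀ * (Sᵀ * Jmat n * S) * T = Tᵀ * Sᵀ * Jmat n * (S * T) := by
      simp only [Matrix.mul_assoc]
    simp only [h2, hTt, hST, Matrix.one_mul, Matrix.mul_one] at h1
    exact h1.symm
  have htr : ∀ Y : Matrix (Idx n) (Idx k) ℝ,
      ((S * Y)ᵀ * M * (S * Y)).trace = (Yᵀ * diagPair d * Y).trace := by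
    intro Y
    rw [← hSM, transpose_mul]
    simp only [Matrix.mul_assoc]
  obtain ⟨Z, hZ, rfl⟩ : ∃ Z : Matrix (Idx n) (Idx k) ℝ, Symplectic Z ∧ S * Z = X :=
    ⟨T * X, hT.mul hX, by rw [← Matrix.mul_assoc, hST, Matrix.one_mul]⟩
  have hmin : (∀ Y : Matrix (Idx n) (Idx k) ℝ, Symplectic Y →
        ((S * Z)ᵀ * M * (S * Z)).trace ≤ (Yᵀ * M * Y).trace) ↔
      ∀ Y : Matrix (Idx n) (Idx k) ℝ, Symplectic Y →
        (Zᵀ * diagPair d * Z).trace ≤ (Yᵀ * diagPair d * Y).trace := by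
    rw [htr]
    refine ⟨fun h Y hY => htr Y ▸ h _ (hS.mul hY), fun h Y hY => ?_⟩
    have := h _ (hT.mul hY)
    rwa [← htr (T * Y), ← Matrix.mul_assoc S, hST, Matrix.one_mul] at this
  rw [hmin, diagPair_minimizer_iff hk hd hmono hZ]
  refine exists_congr fun K => and_congr_right fun _ => ?_
  set O := offPair fun j : Fin k => d (Fin.castLE hk j)
  have h1 : Sᵀ * (M * (S * Z * K)) = diagPair d * (Z * K) := by
    rw [← hSM]
    simp only [Matrix.mul_assoc]
  have h2 : Sᵀ * (Jmat n * (S * Z * K) * O) = Jmat n * (Z * K) * O := by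
    conv_rhs => rw [← hS]
    simp only [Matrix.mul_assoc]
  rw [← h1, ← h2]
  refine ⟨fun h => ?_, fun h => by rw [h]⟩
  have := congrArg (Tᵀ * ·) h
  simpa only [← Matrix.mul_assoc, hTt, Matrix.one_mul] using this
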